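/- Every binary one-stage tree 𝒯 ∈ 𝔗_{2,d} has toric structure, and its algebra equals the full Veronese algebra: after substituting z = θ₁ + θ₂, the ℝ-subalgebra of ℝ[θ₁,θ₂] generated by the elements θ^{i_λ}·(θ₁+θ₂)^{d−|i_λ|} over all root-to-leaf paths λ of 𝒯 is exactly the ℝ-subalgebra im ν_{2,d} generated by all monomials of degree d in θ₁, θ₂. In particular, ker φ_𝒯 is generated by binomials after a linear change of variables. -/

import Mathlib

noncomputable section
open scoped Classical
open MvPolynomial

/-- A staged tree: a finite rooted tree with edges directed away from the root,
each non-root vertex `c` carrying the label `label c` of the edge from `parent c` to `c`;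
labels of outgoing edges of a vertex are pairwise distinct, and the outgoing label sets
of two vertices are either equal (same stage) or disjoint. -/
structure StagedTree (Θ : Type) [DecidableEq Θ] : Type 1 where
  V : Type
  fintypeV : Fintype V
  decEqV : DecidableEq V
  root : V
  parent : V → V
  label : V → Θ
  parent_root : parent root = root
  reaches_root : ∀ v : V, ∃ n : ℕ, parent^[n] v = root
  label_inj : ∀ u v : V, u ≠ root → v ≠ root → parent u = parent v → label u = label v → u = v
  stage_disjoint : ∀ u v : V,
    (∀ θ : Θ, (∃ c, c ≠ root ∧ parent c = u ∧ label c = θ) ↔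
        (∃ c, c ≠ root ∧ parent c = v ∧ label c = θ)) ∨
    (∀ θ : Θ, ¬((∃ c, c ≠ root ∧ parent c = u ∧ label c = θ) ∧
        (∃ c, c ≠ root ∧ parent c = v ∧ label c = θ)))

namespace StagedTree

attribute [instance] StagedTree.fintypeV StagedTree.decEqV

variable {Θ : Type} [DecidableEq Θ] (T : StagedTree Θ)

/-- `c` is a child of `v`. -/
def IsChild (v c : T.V) : Prop := c ≠ T.root ∧ T.parent c = v

/-- `v` is a leaf (no children). -/
def IsLeaf (v : T.V) : Prop := ∀ c, ¬ T.IsChild v c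

/-- `w` lies in the subtree rooted at `v` (i.e. `v` is an ancestor of `w` or `w` itself). -/
def Desc (v w : T.V) : Prop := ∃ n : ℕ, T.parent^[n] w = v

/-- Distance of `v` from the root. -/
def depthOf (v : T.V) : ℕ := Nat.find (T.reaches_root v)

/-- The depth `d` of the tree: maximal number of edges on a root-to-leaf path. -/
def depth : ℕ := Finset.univ.sup T.depthOf

/-- The type of leaves of `T`. -/
def Leaf : Type := {v : T.V // T.IsLeaf v}

instance : Fintype T.Leaf := Subtype.fintype _

/-- Product of the labels along the root-to-`v` path, in `ℝ[Θ]`. -/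
def pathProd (v : T.V) : MvPolynomial Θ ℝ :=
  ∏ i ∈ Finset.range (T.depthOf v), X (T.label (T.parent^[i] v))

/-- Homogenised root-to-`v` path monomial `z^(d - d(λ)) ∏ θ(e)` in `ℝ[Θ, z]`,
where the variable `none` plays the role of `z`. -/
def hpm (v : T.V) : MvPolynomial (Option Θ) ℝ :=
  (X none) ^ (T.depth - T.depthOf v) *
    ∏ i ∈ Finset.range (T.depthOf v), X (some (T.label (T.parent^[i] v)))

/-- The ideal `⟨θ - z⟩` of homogenised local sum-to-one conditions. -/
def sumIdeal : Ideal (MvPolynomial (Option Θ) ℝ) :=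
  Ideal.span {f | ∃ v : T.V, ¬ T.IsLeaf v ∧
    f = (∑ c ∈ Finset.univ.filter (fun c => T.IsChild v c), X (some (T.label c))) - X none}

/-- The homogenised parametrisation `φ_T : ℝ[p] → ℝ[Θ, z]/⟨θ - z⟩`. -/
def phi : MvPolynomial T.Leaf ℝ →ₐ[ℝ] MvPolynomial (Option Θ) ℝ ⧸ T.sumIdeal :=
  aeval (fun l : T.Leaf => Ideal.Quotient.mk T.sumIdeal (T.hpm l.1))

/-- The ideal `⟨θ - 1⟩` of local sum-to-one conditions. -/
def oneIdeal : Ideal (MvPolynomial Θ ℝ) :=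
  Ideal.span {f | ∃ v : T.V, ¬ T.IsLeaf v ∧
    f = (∑ c ∈ Finset.univ.filter (fun c => T.IsChild v c), X (T.label c)) - 1}

/-- The (non-homogenised) parametrisation `φ_T : ℝ[p] → ℝ[Θ]/⟨θ - 1⟩`. -/
def phi1 : MvPolynomial T.Leaf ℝ →ₐ[ℝ] MvPolynomial Θ ℝ ⧸ T.oneIdeal :=
  aeval (fun l : T.Leaf => Ideal.Quotient.mk T.oneIdeal (T.pathProd l.1))

/-- The subtree polynomial `t(v)`: sum over all `v`-to-leaf paths of the products of
edge labels along the path. -/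
def tpoly (v : T.V) : MvPolynomial Θ ℝ :=
  ∑ l ∈ Finset.univ.filter (fun w => T.IsLeaf w ∧ T.Desc v w),
    ∏ i ∈ Finset.range (T.depthOf l - T.depthOf v), X (T.label (T.parent^[i] l))

/-- Two non-leaf vertices are in the same stage when their outgoing label sets coincide. -/
def SameStage (u v : T.V) : Prop :=
  ¬ T.IsLeaf u ∧ ¬ T.IsLeaf v ∧
    ∀ θ : Θ, (∃ c, T.IsChild u c ∧ T.label c = θ) ↔ (∃ c, T.IsChild v c ∧ T.label c = θ)

/-- `T` is balanced: `t(u_i)·t(v_j) = t(u_j)·t(v_i)` for all `u ∼ v` and all pairs of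
children matched via the common labels. -/
def Balanced : Prop :=
  ∀ u v ui uj vi vj : T.V, T.SameStage u v →
    T.IsChild u ui → T.IsChild u uj → T.IsChild v vi → T.IsChild v vj →
    T.label ui = T.label vi → T.label uj = T.label vj →
    T.tpoly ui * T.tpoly vj = T.tpoly uj * T.tpoly vi

/-- `p_{[v]}`: sum of the variables `p_r` over root-to-leaf paths through `v`. -/
def pSum (v : T.V) : MvPolynomial T.Leaf ℝ :=
  ∑ l ∈ Finset.univ.filter (fun l : T.Leaf => T.Desc v l.1), X l

/-- `T` has toric structure: there are linearly independent linear forms in which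
`ker φ_T` is generated by binomials. -/
def Toric : Prop :=
  ∃ L : T.Leaf → MvPolynomial T.Leaf ℝ,
    (∀ i, (L i).IsHomogeneous 1) ∧ LinearIndependent ℝ L ∧
    ∃ B : Set (MvPolynomial T.Leaf ℝ),
      (∀ f ∈ B, ∃ a b : T.Leaf → ℕ, f = (∏ i, L i ^ a i) - (∏ i, L i ^ b i)) ∧
      RingHom.ker T.phi.toRingHom = Ideal.span B

end StagedTree

namespace StagedTree

variable (T : StagedTree (Fin 2))

open MvPolynomial

/-- The generator of the algebra of a binary one-stage tree associated to the root-to-leaf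
path ending at `l`: `θ^{i_λ}·(θ₁+θ₂)^{d−|i_λ|}` in `ℝ[θ₁,θ₂]`. -/
def binGen (l : T.Leaf) : MvPolynomial (Fin 2) ℝ :=
  T.pathProd l.1 * (∑ i : Fin 2, X i) ^ (T.depth - T.depthOf l.1)

section Algebra

/-- A homomorphism of polynomial algebras that sends, after a surjective change of variables, each
variable to a monomial has kernel generated by pure binomials in the new variables. -/
theorem ker_eq_span_binomials {ι κ : Type} [Fintype ι]
    (F : MvPolynomial ι ℝ →ₐ[ℝ] MvPolynomial κ ℝ) (L : ι → MvPolynomial ι ℝ)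
    (hL : Function.Surjective (aeval (R := ℝ) L)) (m : ι → κ →₀ ℕ)
    (hF : ∀ i, F (L i) = monomial (m i) 1) :
    RingHom.ker F.toRingHom = Ideal.span {f | ∃ a b : ι → ℕ,
      f = (∏ i, L i ^ a i) - (∏ i, L i ^ b i) ∧ F f = 0} := by
  set B : Set (MvPolynomial ι ℝ) := {f | ∃ a b : ι → ℕ,
      f = (∏ i, L i ^ a i) - (∏ i, L i ^ b i) ∧ F f = 0}
  have hFprod : ∀ a : ι → ℕ, F (∏ i, L i ^ a i) = monomial (∑ i, a i • m i) 1 := by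
    intro a
    simp only [map_prod, map_pow, hF, monomial_pow, one_pow]
    rw [← monomial_sum_one]
  apply le_antisymm
  · intro f hf
    obtain ⟨g, rfl⟩ := hL f
    let σ : MvPolynomial κ ℝ →ₗ[ℝ] MvPolynomial ι ℝ ⧸ Ideal.span B :=
      (basisMonomials κ ℝ).constr ℝ fun n =>
        if h : ∃ a : ι → ℕ, ∑ i, a i • m i = n then
          Ideal.Quotient.mk (Ideal.span B) (∏ i, L i ^ h.choose i) else 0
    have hσ : ∀ g : MvPolynomial ι ℝ, σ (F (aeval L g)) =
        Ideal.Quotient.mk (Ideal.span B) (aeval L g) := by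
      intro g
      have key : σ ∘ₗ F.toLinearMap ∘ₗ (aeval (R := ℝ) L).toLinearMap =
          (Ideal.Quotient.mkₐ ℝ (Ideal.span B)).toLinearMap ∘ₗ
            (aeval (R := ℝ) L).toLinearMap := by
        refine (basisMonomials ι ℝ).ext fun a => ?_
        have hev : aeval (R := ℝ) L (monomial a 1) = ∏ i, L i ^ a i := by
          rw [aeval_monomial, map_one, one_mul, Finsupp.prod_fintype _ _ (by simp)]
        have hex : ∃ b : ι → ℕ, ∑ i, b i • m i = ∑ i, a i • m i := ⟨a, rfl⟩
        have hσm : σ (monomial (∑ i, a i • m i) 1) =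
            Ideal.Quotient.mk (Ideal.span B) (∏ i, L i ^ hex.choose i) := by
          rw [show (monomial (∑ i, a i • m i) 1 : MvPolynomial κ ℝ) =
            basisMonomials κ ℝ (∑ i, a i • m i) from rfl, Module.Basis.constr_basis, dif_pos hex]
        simp only [coe_basisMonomials, LinearMap.comp_apply, AlgHom.toLinearMap_apply,
          Ideal.Quotient.mkₐ_eq_mk, hev, hFprod, hσm]
        rw [Ideal.Quotient.eq]
        refine Ideal.subset_span ⟨_, _, rfl, ?_⟩
        rw [map_sub, hFprod, hFprod, hex.choose_spec, sub_self]
      exact LinearMap.congr_fun key g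
    have h0 : F (aeval L g) = 0 := hf
    rw [← Ideal.Quotient.eq_zero_iff_mem, ← hσ, h0, map_zero]
  · rw [Ideal.span_le]
    rintro f ⟨a, b, -, hf⟩
    exact hf

/-- A linear map to a polynomial ring whose range is spanned by monomials admits a basis of the
source all of whose members are sent to monomials of that set. -/
theorem exists_basis_map_mem {ι M : Type} [Fintype ι] [AddCommGroup M] [Module ℝ M]
    (π : (ι → ℝ) →ₗ[ℝ] M) (S : Set M) (hS : S.Nonempty)
    (hπ : LinearMap.range π = Submodule.span ℝ S) :
    ∃ b : Module.Basis ι ℝ (ι → ℝ), ∀ i, π (b i) ∈ S := by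
  have hspan : Submodule.span ℝ (π ⁻¹' S) = ⊤ := by
    have hSr : S ⊆ Set.range π := fun x hx => by
      have : x ∈ LinearMap.range π := hπ ▸ Submodule.subset_span hx
      exact this
    have hker : LinearMap.ker π ≤ Submodule.span ℝ (π ⁻¹' S) := by
      intro k hk
      obtain ⟨x, hx⟩ := hS
      obtain ⟨e, rfl⟩ := hSr hx
      have h1 : e + k ∈ π ⁻¹' S := by
        simpa [LinearMap.mem_ker.1 hk] using hx
      simpa using Submodule.sub_mem _ (Submodule.subset_span h1)
        (Submodule.subset_span (show e ∈ π ⁻¹' S from hx))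
    have hmap : Submodule.map π (Submodule.span ℝ (π ⁻¹' S)) = LinearMap.range π := by
      rw [Submodule.map_span, Set.image_preimage_eq_of_subset hSr, hπ]
    rw [← sup_eq_left.2 hker, ← Submodule.comap_map_eq, hmap, LinearMap.range_eq_map,
      Submodule.comap_map_eq, top_sup_eq]
  obtain ⟨s, hs, hss, hli⟩ := exists_linearIndependent ℝ (π ⁻¹' S)
  let b₀ : Module.Basis s ℝ (ι → ℝ) :=
    Module.Basis.mk hli (by rw [Subtype.range_coe, hss, hspan])
  refine ⟨b₀.reindex (b₀.indexEquiv (Pi.basisFun ℝ ι)), fun i => ?_⟩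
  rw [Module.Basis.reindex_apply, Module.Basis.mk_apply]
  exact hs (Subtype.mem _)

/-- A homogeneous polynomial is a linear combination of the monomials of its degree. -/
theorem mem_span_monomials_of_isHomogeneous {κ : Type} {n : ℕ} {p : MvPolynomial κ ℝ}
    (hp : p.IsHomogeneous n) :
    p ∈ Submodule.span ℝ {f : MvPolynomial κ ℝ |
      ∃ a : κ →₀ ℕ, (a.sum fun _ e => e) = n ∧ f = monomial a 1} := by
  rw [p.as_sum]
  refine Submodule.sum_mem _ fun a ha => ?_
  have : monomial a (coeff a p) = coeff a p • (monomial a 1 : MvPolynomial κ ℝ) := by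
    rw [smul_monomial, smul_eq_mul, mul_one]
  rw [this]
  refine Submodule.smul_mem _ _ (Submodule.subset_span ⟨a, ?_, rfl⟩)
  have := hp (mem_support_iff.1 ha)
  simpa [Finsupp.weight_apply] using this

end Algebra

section Tree

variable {Θ : Type} [DecidableEq Θ] (T : StagedTree Θ)

theorem depthOf_eq_succ {v : T.V} (hv : v ≠ T.root) :
    T.depthOf v = T.depthOf (T.parent v) + 1 :=
  Nat.find_comp_succ (T.reaches_root v) (T.reaches_root (T.parent v)) hv

theorem depthOf_root : T.depthOf T.root = 0 :=
  (Nat.find_eq_zero _).2 rfl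

theorem depthOf_le_depth (v : T.V) : T.depthOf v ≤ T.depth :=
  Finset.le_sup (Finset.mem_univ v)

theorem exists_depthOf_eq_depth : ∃ v, T.depthOf v = T.depth := by
  obtain ⟨v, -, hv⟩ := Finset.exists_mem_eq_sup Finset.univ ⟨T.root, Finset.mem_univ _⟩ T.depthOf
  exact ⟨v, hv.symm⟩

theorem pathProd_root : T.pathProd T.root = 1 := by
  rw [pathProd, depthOf_root, Finset.range_zero, Finset.prod_empty]

theorem pathProd_eq_mul {v : T.V} (hv : v ≠ T.root) :
    T.pathProd v = T.pathProd (T.parent v) * X (T.label v) := by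
  rw [pathProd, depthOf_eq_succ T hv, Finset.prod_range_succ']
  rfl

theorem pathProd_isHomogeneous (v : T.V) : (T.pathProd v).IsHomogeneous (T.depthOf v) := by
  simpa [pathProd] using IsHomogeneous.prod (Finset.range (T.depthOf v))
    (fun i => (X (T.label (T.parent^[i] v)) : MvPolynomial Θ ℝ)) (fun _ => 1)
    (fun i _ => isHomogeneous_X _ _)

end Tree

section Binary

variable (T : StagedTree (Fin 2))

theorem binGen_isHomogeneous (l : T.Leaf) : (T.binGen l).IsHomogeneous T.depth := by
  have h := (T.pathProd_isHomogeneous l.1).mul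
    ((IsHomogeneous.sum Finset.univ (fun i : Fin 2 => (X i : MvPolynomial (Fin 2) ℝ)) 1
      (fun i _ => isHomogeneous_X _ _)).pow (T.depth - T.depthOf l.1))
  rwa [one_mul, Nat.add_sub_cancel' (T.depthOf_le_depth l.1)] at h

/-- The homogenised monomial of every vertex, not just of a leaf, is spanned by `binGen`. -/
theorem pathProd_mul_pow_mem_span
    (honestage : ∀ v : T.V, ¬ T.IsLeaf v → ∀ θ : Fin 2, ∃ c, T.IsChild v c ∧ T.label c = θ)
    (v : T.V) :
    T.pathProd v * (∑ i : Fin 2, X i) ^ (T.depth - T.depthOf v) ∈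
      Submodule.span ℝ (Set.range T.binGen) := by
  induction hn : T.depth - T.depthOf v using Nat.strong_induction_on generalizing v with
  | _ n ih =>
  by_cases hv : T.IsLeaf v
  · exact Submodule.subset_span ⟨⟨v, hv⟩, by rw [← hn]; rfl⟩
  have hchild : ∀ θ : Fin 2, n = (n - 1) + 1 ∧
      T.pathProd v * X θ * (∑ i : Fin 2, X i) ^ (n - 1) ∈
        Submodule.span ℝ (Set.range T.binGen) := by
    intro θ
    obtain ⟨c, ⟨hc, rfl⟩, rfl⟩ := honestage v hv θ
    have h1 := T.depthOf_eq_succ hc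
    have h2 := T.depthOf_le_depth c
    refine ⟨by omega, ?_⟩
    rw [← T.pathProd_eq_mul hc]
    exact ih (n - 1) (by omega) c (by omega)
  rw [(hchild 0).1, pow_succ]
  have := Submodule.add_mem _ (hchild 0).2 (hchild 1).2
  convert this using 1
  rw [Fin.sum_univ_two]
  ring

/-- If every multiple of the path monomial of `v` by a monomial of complementary degree is spanned by
`binGen`, then the same holds for the parent of `v`. -/
theorem pathProd_parent_mul_mem_span
    (honestage : ∀ v : T.V, ¬ T.IsLeaf v → ∀ θ : Fin 2, ∃ c, T.IsChild v c ∧ T.label c = θ)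
    {v : T.V} (hv : v ≠ T.root)
    (h : ∀ i j : Fin 2, i ≠ j → ∀ a b : ℕ, a + b = T.depth - T.depthOf v →
      T.pathProd v * (X i ^ a * X j ^ b) ∈ Submodule.span ℝ (Set.range T.binGen))
    (i j : Fin 2) (hij : i ≠ j) (a b : ℕ) (hab : a + b = T.depth - T.depthOf (T.parent v)) :
    T.pathProd (T.parent v) * (X i ^ a * X j ^ b) ∈ Submodule.span ℝ (Set.range T.binGen) := by
  have hd := T.depthOf_eq_succ hv
  have hle := T.depthOf_le_depth v
  have hP := T.pathProd_eq_mul hv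
  set u := T.parent v with hu
  set m := T.depth - T.depthOf v with hm
  wlog hi : T.label v = i generalizing i j a b
  · rw [mul_comm (X i ^ a)]
    exact this j i hij.symm b a (by omega) (by omega)
  subst hi
  have hmul : ∀ a b : ℕ, a + b = m →
      T.pathProd u * (X (T.label v) ^ (a + 1) * X j ^ b) ∈
        Submodule.span ℝ (Set.range T.binGen) := by
    intro a b hab
    convert h (T.label v) j hij a b hab using 1
    rw [hP]
    ring
  rcases a with _ | a
  · obtain rfl : b = m + 1 := by omega
    have hleaf : ¬ T.IsLeaf u := fun hl => hl v ⟨hv, rfl⟩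
    obtain ⟨w, ⟨hw, hwu⟩, rfl⟩ := honestage u hleaf j
    have hwd := T.depthOf_eq_succ hw
    have hwP := T.pathProd_eq_mul hw
    rw [hwu] at hwd hwP
    have hwm := T.pathProd_mul_pow_mem_span honestage w
    have hsum : (∑ i : Fin 2, X i : MvPolynomial (Fin 2) ℝ) = X (T.label v) + X (T.label w) := by
      rw [Fin.sum_univ_two]
      generalize T.label v = p at hij
      generalize T.label w = q at hij
      fin_cases p <;> fin_cases q <;> simp_all [add_comm]
    rw [show T.depth - T.depthOf w = m by omega, hwP, hsum, add_pow,
      Finset.sum_range_succ'] at hwm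
    have hrest : ∑ k ∈ Finset.range m, (m.choose (k + 1) : ℝ) • (T.pathProd u *
        (X (T.label v) ^ (k + 1) * X (T.label w) ^ (m - k))) ∈
        Submodule.span ℝ (Set.range T.binGen) :=
      Submodule.sum_mem _ fun k hk => Submodule.smul_mem _ _ (hmul k (m - k) (by
        have := Finset.mem_range.1 hk; omega))
    convert Submodule.sub_mem _ hwm hrest using 1
    rw [mul_add, Finset.mul_sum, add_sub_right_comm, ← Finset.sum_sub_distrib,
      Finset.sum_eq_zero]
    · simp
      ring
    · intro k hk
      have := Finset.mem_range.1 hk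
      rw [show m - k = (m - (k + 1)) + 1 by omega, MvPolynomial.smul_eq_C_mul, map_natCast]
      ring
  · exact hmul a b (by omega)

theorem monomial_mem_span
    (honestage : ∀ v : T.V, ¬ T.IsLeaf v → ∀ θ : Fin 2, ∃ c, T.IsChild v c ∧ T.label c = θ)
    (a : Fin 2 →₀ ℕ) (ha : (a.sum fun _ e => e) = T.depth) :
    monomial a 1 ∈ Submodule.span ℝ (Set.range T.binGen) := by
  have key : ∀ (n : ℕ) (v : T.V), T.parent^[n] v = T.root →
      (∀ i j : Fin 2, i ≠ j → ∀ a b : ℕ, a + b = T.depth - T.depthOf v →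
        T.pathProd v * (X i ^ a * X j ^ b) ∈ Submodule.span ℝ (Set.range T.binGen)) →
      ∀ i j : Fin 2, i ≠ j → ∀ a b : ℕ, a + b = T.depth - T.depthOf T.root →
        T.pathProd T.root * (X i ^ a * X j ^ b) ∈ Submodule.span ℝ (Set.range T.binGen) := by
    intro n
    induction n with
    | zero => rintro v rfl h; exact h
    | succ n ih =>
      intro v hn h
      by_cases hv : v = T.root
      · rwa [hv] at h
      · exact ih (T.parent v) hn (T.pathProd_parent_mul_mem_span honestage hv h)
  obtain ⟨v, hv⟩ := T.exists_depthOf_eq_depth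
  obtain ⟨n, hn⟩ := T.reaches_root v
  have hbase : ∀ i j : Fin 2, i ≠ j → ∀ a b : ℕ, a + b = T.depth - T.depthOf v →
      T.pathProd v * (X i ^ a * X j ^ b) ∈ Submodule.span ℝ (Set.range T.binGen) := by
    intro i j _ a b hab
    obtain ⟨rfl, rfl⟩ : a = 0 ∧ b = 0 := by omega
    simpa [hv] using T.pathProd_mul_pow_mem_span honestage v
  rw [Finsupp.sum_fintype _ _ (by simp), Fin.sum_univ_two] at ha
  have := key n v hn hbase 0 1 (by decide) (a 0) (a 1) (by rw [depthOf_root]; omega)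
  rw [pathProd_root, one_mul] at this
  rwa [monomial_eq, map_one, one_mul, Finsupp.prod_fintype _ _ (by simp), Fin.prod_univ_two]

theorem span_binGen
    (honestage : ∀ v : T.V, ¬ T.IsLeaf v → ∀ θ : Fin 2, ∃ c, T.IsChild v c ∧ T.label c = θ) :
    Submodule.span ℝ (Set.range T.binGen) =
    Submodule.span ℝ {f : MvPolynomial (Fin 2) ℝ |
      ∃ a : Fin 2 →₀ ℕ, (a.sum fun _ e => e) = T.depth ∧ f = monomial a 1} := by
  apply le_antisymm <;> rw [Submodule.span_le]
  · rintro _ ⟨l, rfl⟩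
    exact mem_span_monomials_of_isHomogeneous (T.binGen_isHomogeneous l)
  · rintro _ ⟨a, ha, rfl⟩
    exact T.monomial_mem_span honestage a ha

theorem sum_X_label_eq
    (honestage : ∀ v : T.V, ¬ T.IsLeaf v → ∀ θ : Fin 2, ∃ c, T.IsChild v c ∧ T.label c = θ)
    {v : T.V} (hv : ¬ T.IsLeaf v) :
    (∑ c ∈ Finset.univ.filter (fun c => T.IsChild v c),
      (X (some (T.label c)) : MvPolynomial (Option (Fin 2)) ℝ)) =
      ∑ i : Fin 2, X (some i) := by
  refine Finset.sum_bij (fun c _ => T.label c) (fun _ _ => Finset.mem_univ _) ?_ ?_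
    (fun _ _ => rfl)
  · intro c hc c' hc' h
    obtain ⟨h1, h2⟩ := (Finset.mem_filter.1 hc).2
    obtain ⟨h3, h4⟩ := (Finset.mem_filter.1 hc').2
    exact T.label_inj c c' h1 h3 (h2.trans h4.symm) h
  · intro i _
    obtain ⟨c, hc, rfl⟩ := honestage v hv i
    exact ⟨c, Finset.mem_filter.2 ⟨Finset.mem_univ _, hc⟩, rfl⟩

/-- Eliminating `z` by the substitution `z = θ₁ + θ₂` does not change the kernel. -/
theorem ker_phi
    (honestage : ∀ v : T.V, ¬ T.IsLeaf v → ∀ θ : Fin 2, ∃ c, T.IsChild v c ∧ T.label c = θ) :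
    RingHom.ker T.phi.toRingHom =
    RingHom.ker (aeval (R := ℝ) T.binGen).toRingHom := by
  have hbg : ∀ l, T.phi (X l) =
      Ideal.Quotient.mkₐ ℝ T.sumIdeal (rename some (T.binGen l)) := by
    intro l
    simp only [phi, aeval_X, Ideal.Quotient.mkₐ_eq_mk, hpm, binGen, pathProd, map_mul, map_pow,
      map_prod, rename_X, map_sum]
    rw [mul_comm]
    congr 1
    by_cases hd : T.depth = 0
    · simp [hd]
    have hroot : ¬ T.IsLeaf T.root := by
      intro hl
      obtain ⟨v, hv⟩ := T.exists_depthOf_eq_depth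
      have hall : ∀ n : ℕ, ∀ v, T.depthOf v = n → n = 0 := by
        intro n
        induction n with
        | zero => simp
        | succ n ih =>
          intro v hv
          have hne : v ≠ T.root := by
            rintro rfl
            rw [depthOf_root] at hv
            omega
          have h1 := T.depthOf_eq_succ hne
          obtain rfl := ih (T.parent v) (by omega)
          have h2 : T.parent v = T.root := (Nat.find_eq_zero (T.reaches_root _)).1 (by
            show T.depthOf (T.parent v) = 0
            omega)
          exact absurd ⟨hne, h2⟩ (hl v)
      exact hd (hall _ v hv)
    congr 1
    rw [← map_sum, eq_comm, Ideal.Quotient.eq]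
    exact Ideal.subset_span ⟨T.root, hroot, by rw [T.sum_X_label_eq honestage hroot]⟩
  let ev : MvPolynomial (Option (Fin 2)) ℝ →ₐ[ℝ] MvPolynomial (Fin 2) ℝ :=
    aeval fun o => o.elim (∑ i : Fin 2, X i) X
  have hev : ∀ f ∈ T.sumIdeal, ev f = 0 := by
    intro f hf
    have hle : T.sumIdeal ≤ RingHom.ker ev := by
      refine Ideal.span_le.2 ?_
      rintro f ⟨v, hv, rfl⟩
      simp [T.sum_X_label_eq honestage hv, ev, RingHom.mem_ker]
    exact hle hf
  have hforth : T.phi = ((Ideal.Quotient.mkₐ ℝ T.sumIdeal).comp (rename some)).comp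
      (aeval T.binGen) := by
    refine algHom_ext fun l => ?_
    rw [hbg]
    simp
  have hback : (Ideal.Quotient.liftₐ T.sumIdeal ev hev).comp T.phi = aeval T.binGen := by
    refine algHom_ext fun l => ?_
    rw [AlgHom.comp_apply, hbg]
    have : ev.comp (rename some) = AlgHom.id ℝ (MvPolynomial (Fin 2) ℝ) :=
      algHom_ext fun i => by simp [ev]
    rw [aeval_X]
    exact AlgHom.congr_fun this (T.binGen l)
  ext f
  change T.phi f = 0 ↔ aeval T.binGen f = 0
  refine ⟨fun h => ?_, fun h => ?_⟩
  · rw [← hback, AlgHom.comp_apply, h, map_zero]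
  · rw [hforth, AlgHom.comp_apply, h, map_zero]

theorem toric_of_binary_oneStage
    (honestage : ∀ v : T.V, ¬ T.IsLeaf v → ∀ θ : Fin 2, ∃ c, T.IsChild v c ∧ T.label c = θ) :
    T.Toric := by
  obtain ⟨b, hb⟩ := exists_basis_map_mem (Fintype.linearCombination ℝ T.binGen)
    {f : MvPolynomial (Fin 2) ℝ |
      ∃ a : Fin 2 →₀ ℕ, (a.sum fun _ e => e) = T.depth ∧ f = monomial a 1}
    ⟨_, Finsupp.single 0 T.depth, by simp, rfl⟩
    (by rw [Fintype.range_linearCombination, T.span_binGen honestage])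
  choose m _ hm using hb
  let lin : (T.Leaf → ℝ) →ₗ[ℝ] MvPolynomial T.Leaf ℝ := Fintype.linearCombination ℝ X
  have hlin : ∀ e, lin e = ∑ l, e l • X l := fun e => Fintype.linearCombination_apply ..
  have hinj : LinearMap.ker lin = ⊥ :=
    LinearMap.ker_eq_bot.2
      (linearIndependent_X (σ := T.Leaf) (R := ℝ)).fintypeLinearCombination_injective
  have hsurj : Function.Surjective (aeval (R := ℝ) fun i => lin (b i)) := by
    rw [← AlgHom.range_eq_top, ← top_le_iff, ← adjoin_range_X, Algebra.adjoin_le_iff]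
    rintro _ ⟨l, rfl⟩
    have hX : X l = lin (Pi.single l 1) := by
      rw [Fintype.linearCombination_apply_single, one_smul]
    rw [hX, ← b.sum_repr (Pi.single l 1), map_sum]
    refine Subalgebra.sum_mem _ fun i _ => ?_
    rw [map_smul]
    exact Subalgebra.smul_mem _ ((AlgHom.mem_range _).2 ⟨X i, aeval_X _ _⟩) _
  refine ⟨fun i => lin (b i), fun i => ?_, b.linearIndependent.map' lin hinj, _, ?_,
    (T.ker_phi honestage).trans (ker_eq_span_binomials _ _ hsurj m fun i => ?_)⟩
  · simp only [hlin]
    refine IsHomogeneous.sum _ _ _ fun l _ => ?_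
    rw [smul_eq_C_mul]
    simpa using (isHomogeneous_C T.Leaf (b i l)).mul (isHomogeneous_X ℝ l)
  · rintro f ⟨a, c, h, -⟩
    exact ⟨a, c, h⟩
  · rw [← hm, hlin, Fintype.linearCombination_apply]
    simp

end Binary

/-- Every binary one-stage tree `𝒯 ∈ 𝔗_{2,d}` has toric structure, and
its algebra equals the full Veronese algebra `im ν_{2,d}`: after substituting
`z = θ₁ + θ₂`, the ℝ-subalgebra of `ℝ[θ₁,θ₂]` generated by the elements
`θ^{i_λ}·(θ₁+θ₂)^{d−|i_λ|}` over the root-to-leaf paths equals the subalgebra generated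
by all monomials of degree `d`; in particular `ker φ_𝒯` is generated by binomials after a
linear change of variables. -/
theorem binary_oneStage_toric_and_veronese
    (honestage : ∀ v : T.V, ¬ T.IsLeaf v → ∀ θ : Fin 2, ∃ c, T.IsChild v c ∧ T.label c = θ) :
    Algebra.adjoin ℝ (Set.range (T.binGen)) =
      Algebra.adjoin ℝ {f : MvPolynomial (Fin 2) ℝ |
        ∃ a : Fin 2 →₀ ℕ, (a.sum fun _ e => e) = T.depth ∧ f = monomial a 1} ∧
    T.Toric := by
  refine ⟨?_, T.toric_of_binary_oneStage honestage⟩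
  rw [← Algebra.adjoin_span, T.span_binGen honestage, Algebra.adjoin_span]

end StagedTree
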